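/- If an isosceles triangle has integer sides β = γ ≠ α and integer area, then there exist positive integers δ, m, n with m > n, gcd(m,n) = 1 and m + n odd such that either α = 2δ(m²−n²), h = 2δmn, β = γ = δ(m²+n²), or α = 4δmn, h = δ(m²−n²), β = γ = δ(m²+n²), where h is the height to the base. -/

import Mathlib

theorem prim_aux (a b c : ℕ) (ha : 0 < a) (hb : 0 < b) (hc : 0 < c) (H : a * a + b * b = c * c)
    (hcop : Nat.Coprime a b) (hodd : a % 2 = 1) :
    ∃ m n : ℕ, 0 < n ∧ n < m ∧ Nat.Coprime m n ∧ Odd (m + n) ∧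
      a = m ^ 2 - n ^ 2 ∧ b = 2 * m * n ∧ c = m ^ 2 + n ^ 2 := by
  have hp : PythagoreanTriple (a : ℤ) b c := by
    unfold PythagoreanTriple
    exact_mod_cast H
  obtain ⟨m, n, h1, h2, h3, h4, h5, h6⟩ := hp.coprime_classification'
    (by rw [Int.gcd_natCast_natCast]; exact hcop) (by omega) (by omega)
  have hbz : (0 : ℤ) < b := by exact_mod_cast hb
  have haz : (0 : ℤ) < a := by exact_mod_cast ha
  have hn : 0 < n := by
    by_contra hn
    push Not at hn
    nlinarith [mul_nonneg h6 (neg_nonneg.mpr hn)]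
  lift m to ℕ using h6
  lift n to ℕ using hn.le
  have hlt : (n : ℤ) < m := by nlinarith
  refine ⟨m, n, by exact_mod_cast hn, by exact_mod_cast hlt, ?_, ?_, ?_, ?_, ?_⟩
  · rw [Int.gcd_natCast_natCast] at h4; exact h4
  · rw [Nat.odd_iff]; omega
  · have : a + n ^ 2 = m ^ 2 := by
      zify; linarith
    omega
  · exact_mod_cast h2
  · exact_mod_cast h3

theorem pyth_aux (a b c : ℕ) (ha : 0 < a) (hb : 0 < b) (hc : 0 < c) (H : a * a + b * b = c * c) :
    ∃ δ m n : ℕ, 0 < δ ∧ 0 < n ∧ n < m ∧ Nat.Coprime m n ∧ Odd (m + n) ∧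
      ((a = δ * (m ^ 2 - n ^ 2) ∧ b = δ * (2 * m * n) ∧ c = δ * (m ^ 2 + n ^ 2)) ∨
       (a = δ * (2 * m * n) ∧ b = δ * (m ^ 2 - n ^ 2) ∧ c = δ * (m ^ 2 + n ^ 2))) := by
  obtain ⟨g, x, y, hg, hxy, rfl, rfl⟩ := Nat.exists_coprime' (m := a) (n := b) (Nat.gcd_pos_of_pos_left b ha)
  have hgc : g ∣ c := by
    rw [← Nat.pow_dvd_pow_iff (n := 2) (by norm_num)]
    exact ⟨x * x + y * y, by rw [pow_two, ← H]; ring⟩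
  obtain ⟨z, rfl⟩ := hgc
  have hx : 0 < x := Nat.pos_of_mul_pos_right ha
  have hy : 0 < y := Nat.pos_of_mul_pos_right hb
  have hz : 0 < z := Nat.pos_of_mul_pos_left hc
  have H' : x * x + y * y = z * z := by
    have : (g * g) * (x * x + y * y) = (g * g) * (z * z) := by linarith
    exact Nat.eq_of_mul_eq_mul_left (by positivity) this
  rcases Nat.mod_two_eq_zero_or_one x with h0 | h1
  · have hy1 : y % 2 = 1 := by
      by_contra hy0
      have := Nat.dvd_gcd (Nat.dvd_of_mod_eq_zero h0) (show 2 ∣ y by omega)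
      rw [hxy] at this
      omega
    obtain ⟨m, n, h1, h2, h3, h4, h5, h6, h7⟩ := prim_aux y x z hy hx hz (by linarith) hxy.symm hy1
    exact ⟨g, m, n, hg, h1, h2, h3, h4, Or.inr ⟨by rw [h6]; ring, by rw [h5]; ring, by rw [h7]⟩⟩
  · obtain ⟨m, n, h1, h2, h3, h4, h5, h6, h7⟩ := prim_aux x y z hx hy hz H' hxy h1
    exact ⟨g, m, n, hg, h1, h2, h3, h4, Or.inl ⟨by rw [h5]; ring, by rw [h6]; ring, by rw [h7]⟩⟩

theorem stmt_7 (α β : ℕ) (hα : 0 < α) (hβ : 0 < β) (hne : β ≠ α)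
    (htri : α < 2 * β)
    (h E : ℝ)
    (hh : h = Real.sqrt ((β : ℝ) ^ 2 - (α : ℝ) ^ 2 / 4))
    (hE : E = (α : ℝ) * h / 2)
    (e : ℕ) (he : 0 < e) (hEe : E = e) :
    ∃ δ m n : ℕ, 0 < δ ∧ 0 < n ∧ n < m ∧ Nat.Coprime m n ∧ Odd (m + n) ∧
      ((α = 2 * δ * (m ^ 2 - n ^ 2) ∧ h = (2 * δ * m * n : ℕ) ∧ β = δ * (m ^ 2 + n ^ 2)) ∨
       (α = 4 * δ * m * n ∧ h = (δ * (m ^ 2 - n ^ 2) : ℕ) ∧ β = δ * (m ^ 2 + n ^ 2))) := by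
  have htri' : (α : ℝ) < 2 * β := by exact_mod_cast htri
  have hαr : (0 : ℝ) < α := by exact_mod_cast hα
  have hsq : h ^ 2 = (β : ℝ) ^ 2 - (α : ℝ) ^ 2 / 4 := by
    rw [hh, Real.sq_sqrt]; nlinarith
  have hE2 : (α : ℝ) * h = 2 * e := by linarith
  have key : (4 * e) ^ 2 + α ^ 2 * α ^ 2 = α ^ 2 * (2 * β) ^ 2 := by
    have : ((4 * e : ℝ)) ^ 2 + α ^ 2 * α ^ 2 = α ^ 2 * (2 * β) ^ 2 := by
      have h4 : (4 * e : ℝ) = 2 * (α * h) := by linarith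
      rw [h4]
      have : (2 * (α * h)) ^ 2 = 4 * (α : ℝ) ^ 2 * h ^ 2 := by ring
      rw [this, hsq]; ring
    exact_mod_cast this
  have hdvd : α ∣ 4 * e := by
    rw [← Nat.pow_dvd_pow_iff (n := 2) (by norm_num)]
    exact (Nat.dvd_add_left (Dvd.intro _ rfl)).mp (key ▸ Dvd.intro _ rfl)
  obtain ⟨k, hk⟩ := hdvd
  have hk2 : k ^ 2 + α ^ 2 = (2 * β) ^ 2 := by
    rw [hk] at key
    have : α ^ 2 * (k ^ 2 + α ^ 2) = α ^ 2 * (2 * β) ^ 2 := by linarith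
    exact Nat.eq_of_mul_eq_mul_left (by positivity) this
  have hmod : (k ^ 2 + α ^ 2) % 4 = 0 := by
    rw [hk2, mul_pow]; omega
  have hev : k % 2 = 0 ∧ α % 2 = 0 := by
    rcases Nat.even_or_odd' k with ⟨u, rfl | rfl⟩ <;>
    rcases Nat.even_or_odd' α with ⟨v, rfl | rfl⟩ <;> ring_nf at hmod <;> omega
  obtain ⟨b, rfl⟩ := Nat.dvd_of_mod_eq_zero hev.1
  obtain ⟨a, rfl⟩ := Nat.dvd_of_mod_eq_zero hev.2
  have hb : 0 < b := by
    rcases Nat.eq_zero_or_pos b with rfl | hb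
    · omega
    · exact hb
  have hhb : h = b := by
    have h4 : (4 * e : ℝ) = (2 * a : ℕ) * (2 * b : ℕ) := by exact_mod_cast hk
    have : ((2 * a : ℕ) : ℝ) * h = (2 * a : ℕ) * b := by
      push_cast at *
      linarith
    exact mul_left_cancel₀ hαr.ne' this
  obtain ⟨δ, m, n, h1, h2, h3, h4, h5, h6⟩ := pyth_aux a b β (by omega) hb hβ (by nlinarith)
  refine ⟨δ, m, n, h1, h2, h3, h4, h5, ?_⟩
  rcases h6 with ⟨p, q, r⟩ | ⟨p, q, r⟩
  · exact Or.inl ⟨by rw [p]; ring, by rw [hhb, q]; congr 1; ring, r⟩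
  · exact Or.inr ⟨by rw [p]; ring, by rw [hhb, q], r⟩
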